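/- arXiv:1905.08366 — 6 statements merged into one kernel-verified Lean document; each statement's English description precedes it below -/
import Mathlib

section
/- Edge weights in a minimum-weight edge cover (Lemma 4.1): Let V be a finite set with |V| ≥ 2, let w be a nonnegative weight function on the set E of unordered pairs of distinct elements of V, and let K ≥ 0. Suppose that every vertex v ∈ V has at least one incident edge e ∈ E with w(e) ≤ K. Then every edge cover C of minimum total weight (i.e., C is an edge cover and no edge cover has strictly smaller total weight) satisfies w(e) ≤ 2K for every edge e ∈ C. -/
open scoped Classical

/-- The edges of the complete graph on the vertex type `V`:
unordered pairs of distinct vertices. -/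
abbrev CEdge (V : Type*) := {e : Sym2 V // ¬ e.IsDiag}

/-- A set of edges is an edge cover if every vertex is incident to at least one of its edges. -/
def IsCover {V : Type*} (C : Finset (CEdge V)) : Prop :=
  ∀ v : V, ∃ e ∈ C, v ∈ e.1

/-- **Edge weights in a minimum-weight edge cover.**
Let `V` be a finite vertex set with at least two elements, let `w` be a nonnegative weight
function on the edges of the complete graph on `V`, and let `K ≥ 0`.  If every vertex has
an incident edge of weight at most `K`, then every minimum-weight edge cover uses only
edges of weight at most `2K`. -/
theorem minEdgeCover_light_edges
    {V : Type*} [Fintype V] [DecidableEq V] (hV : 2 ≤ Fintype.card V)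
    (w : CEdge V → ℝ) (hw : ∀ e, 0 ≤ w e)
    (K : ℝ) (hK : 0 ≤ K)
    (hshort : ∀ v : V, ∃ e : CEdge V, v ∈ e.1 ∧ w e ≤ K)
    (C : Finset (CEdge V)) (hC : IsCover C)
    (hmin : ∀ C' : Finset (CEdge V), IsCover C' → ∑ e ∈ C, w e ≤ ∑ e ∈ C', w e) :
    ∀ e ∈ C, w e ≤ 2 * K := by
  intro e he
  by_contra! hlt
  have hins : ∀ (f : CEdge V) (S : Finset (CEdge V)),
      ∑ x ∈ insert f S, w x ≤ w f + ∑ x ∈ S, w x := by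
    intro f S
    by_cases hf : f ∈ S
    · rw [Finset.insert_eq_of_mem hf]
      linarith [hw f]
    · rw [Finset.sum_insert hf]
  obtain ⟨a, b, hab⟩ : ∃ a b, e.1 = s(a, b) := by
    induction h : e.1 using Sym2.ind with
    | _ a b => exact ⟨a, b, rfl⟩
  obtain ⟨f, haf, hf⟩ := hshort a
  obtain ⟨g, hbg, hg⟩ := hshort b
  have hcov : IsCover (insert f (insert g (C.erase e))) := by
    intro v
    obtain ⟨x, hx, hv⟩ := hC v
    by_cases hxe : x = e
    · subst hxe
      rw [hab, Sym2.mem_iff] at hv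
      rcases hv with rfl | rfl
      · exact ⟨f, by simp, haf⟩
      · exact ⟨g, by simp, hbg⟩
    · exact ⟨x, by simp [hxe, hx], hv⟩
  have h1 := hmin _ hcov
  have h2 := hins f (insert g (C.erase e))
  have h3 := hins g (C.erase e)
  have h4 := Finset.add_sum_erase C w he
  linarith
end

section
/- Diluted edge cover equals edge cover when cover edges are light (Lemma 4.2): Let V be a finite set with |V| ≥ 2, let w be a nonnegative weight function on the set E of unordered pairs of distinct elements of V, and let K ≥ 0. Suppose there exists a minimum total weight edge cover all of whose edges have weight at most 2K. Then EC_{4K} = EC, where EC is the minimum total weight of an edge cover and EC_{4K} is the minimum over all subsets F ⊆ E of ( Σ_{e ∈ F} w(e) + 2K · #{ v ∈ V : v is incident to no edge of F } ). -/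
open scoped Classical

/-- The minimum total weight of an edge cover of the complete graph on `V`. -/
noncomputable def ECmin (V : Type*) [Fintype V] (w : CEdge V → ℝ) : ℝ :=
  sInf {x | ∃ C : Finset (CEdge V), IsCover C ∧ x = ∑ e ∈ C, w e}

/-- The minimal `λ`-diluted edge cover cost on the complete graph on `V`: the minimum over
all edge sets `F` of the total weight of `F` plus `λ/2` times the number of vertices
incident to no edge of `F`.  Here the penalty per uncovered vertex is given directly as
`pen = λ/2`. -/
noncomputable def ECdiluted (V : Type*) [Fintype V] (w : CEdge V → ℝ) (pen : ℝ) : ℝ :=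
  sInf {x | ∃ F : Finset (CEdge V),
    x = ∑ e ∈ F, w e +
      pen * ((Finset.univ.filter (fun v : V => ∀ e ∈ F, v ∉ e.1)).card : ℝ)}

/-- **Diluted edge cover equals edge cover when cover edges are light.**
Let `V` be a finite vertex set with at least two elements, `w` a nonnegative edge weight
function on the complete graph on `V`, and `K ≥ 0`.  If some minimum-weight edge cover
uses only edges of weight at most `2K`, then the minimal `4K`-diluted cost (penalty `2K`
per uncovered vertex) equals the minimum edge cover weight. -/
theorem dilutedCover_eq_cover_of_light
    {V : Type*} [Fintype V] [DecidableEq V] (hV : 2 ≤ Fintype.card V)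
    (w : CEdge V → ℝ) (hw : ∀ e, 0 ≤ w e)
    (K : ℝ) (hK : 0 ≤ K)
    (hlight : ∃ C : Finset (CEdge V), IsCover C ∧
      (∀ C' : Finset (CEdge V), IsCover C' → ∑ e ∈ C, w e ≤ ∑ e ∈ C', w e) ∧
      ∀ e ∈ C, w e ≤ 2 * K) :
    ECdiluted V w (2 * K) = ECmin V w := by
  rename_i instD
  clear instD
  obtain ⟨C, hC, hmin, hl⟩ := hlight
  have hE : ECmin V w = ∑ e ∈ C, w e := by
    apply IsLeast.csInf_eq
    refine ⟨⟨C, hC, rfl⟩, ?_⟩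
    rintro x ⟨C', hC', rfl⟩
    exact hmin C' hC'
  rw [hE]
  apply IsLeast.csInf_eq
  refine ⟨⟨C, ?_⟩, ?_⟩
  · rw [Finset.filter_false_of_mem]
    · simp
    · intro v _ h
      obtain ⟨e, he, hv⟩ := hC v
      exact h e he hv
  · rintro x ⟨F, rfl⟩
    choose f hfC hfv using hC
    set U := Finset.univ.filter (fun v : V => ∀ e ∈ F, v ∉ e.1) with hU
    have hcov : IsCover (F ∪ U.image f) := by
      intro v
      by_cases h : ∀ e ∈ F, v ∉ e.1
      · exact ⟨f v, Finset.mem_union_right _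
          (Finset.mem_image_of_mem f (by rw [hU]; simpa using h)), hfv v⟩
      · push Not at h
        obtain ⟨e, he, hv⟩ := h
        exact ⟨e, Finset.mem_union_left _ he, hv⟩
    have h1 := hmin _ hcov
    have h2 := Finset.sum_union_inter (s₁ := F) (s₂ := U.image f) (f := w)
    have h3 : 0 ≤ ∑ e ∈ F ∩ U.image f, w e := Finset.sum_nonneg fun e _ => hw e
    have h4 : ∑ e ∈ U.image f, w e ≤ (U.image f).card • (2 * K) := by
      apply Finset.sum_le_card_nsmul
      intro e he
      obtain ⟨v, _, rfl⟩ := Finset.mem_image.1 he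
      exact hl _ (hfC v)
    have h5 : ((U.image f).card : ℝ) ≤ U.card := by exact_mod_cast Finset.card_image_le
    rw [nsmul_eq_mul] at h4
    have h6 : ((U.image f).card : ℝ) * (2 * K) ≤ U.card * (2 * K) :=
      mul_le_mul_of_nonneg_right h5 (by linarith)
    linarith
end

section
/- Recursion for the diluted edge cover increment (Lemma 4.7): Let G be a finite graph with nonnegative edge weights, let λ > 0, let S be a subset of the vertex set of G, and let v ∈ S. Then h_λ(v, G, S) = min( λ/2, min over neighbors u of v in G of ( w_{(v,u)} − h_λ(u, G, S ∖ {v}) ) ), where the inner minimum over an empty set of neighbors is interpreted as +∞ (so that h_λ(v, G, S) = λ/2 if v has no neighbors). -/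
open scoped Classical

/-- The optimal `λ`-diluted cost of covering the vertex set `S` using edges of the graph `G`
with edge weights `w`: the minimum over all sets `F` of edges of `G` of the total weight
of `F` plus `λ/2` times the number of vertices of `S` incident to no edge of `F`. -/
noncomputable def ECdil {V : Type*} [Fintype V] (G : SimpleGraph V) (w : Sym2 V → ℝ)
    (lam : ℝ) (S : Finset V) : ℝ :=
  sInf {x | ∃ F : Finset (Sym2 V), (∀ e ∈ F, e ∈ G.edgeSet) ∧
    x = ∑ e ∈ F, w e + (lam / 2) * ((S.filter (fun s => ∀ e ∈ F, s ∉ e)).card : ℝ)}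

/-- The increment `h_λ(v, G, S) = EC_λ(G, S) - EC_λ(G, S \ {v})`. -/
noncomputable def hdil {V : Type*} [Fintype V] (G : SimpleGraph V) (w : Sym2 V → ℝ)
    (lam : ℝ) (v : V) (S : Finset V) : ℝ :=
  ECdil G w lam S - ECdil G w lam (S.erase v)

theorem ECdil_le {V : Type*} [Fintype V] (G : SimpleGraph V) (w : Sym2 V → ℝ)
    (hw : ∀ e, 0 ≤ w e) (lam : ℝ) (hlam : 0 < lam) (S : Finset V) (F : Finset (Sym2 V))
    (hF : ∀ e ∈ F, e ∈ G.edgeSet) :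
    ECdil G w lam S ≤
      ∑ e ∈ F, w e + (lam / 2) * ((S.filter (fun s => ∀ e ∈ F, s ∉ e)).card : ℝ) := by
  apply csInf_le
  · refine ⟨0, ?_⟩
    rintro x ⟨F, -, rfl⟩
    have := Finset.sum_nonneg (s := F) (fun e _ => hw e)
    positivity
  · exact ⟨F, hF, rfl⟩

theorem ECdil_attained {V : Type*} [Fintype V] (G : SimpleGraph V) (w : Sym2 V → ℝ)
    (lam : ℝ) (S : Finset V) :
    ∃ F : Finset (Sym2 V), (∀ e ∈ F, e ∈ G.edgeSet) ∧ ECdil G w lam S =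
      ∑ e ∈ F, w e + (lam / 2) * ((S.filter (fun s => ∀ e ∈ F, s ∉ e)).card : ℝ) := by
  have hne : {x | ∃ F : Finset (Sym2 V), (∀ e ∈ F, e ∈ G.edgeSet) ∧
    x = ∑ e ∈ F, w e + (lam / 2) *
      ((S.filter (fun s => ∀ e ∈ F, s ∉ e)).card : ℝ)}.Nonempty :=
    ⟨_, ∅, by simp, rfl⟩
  refine hne.csInf_mem ?_
  refine (Set.finite_range (fun F : Finset (Sym2 V) => ∑ e ∈ F, w e + (lam / 2) *
      ((S.filter (fun s => ∀ e ∈ F, s ∉ e)).card : ℝ))).subset ?_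
  rintro x ⟨F, -, rfl⟩
  exact ⟨F, rfl⟩

theorem ECdil_le_half {V : Type*} [Fintype V] (G : SimpleGraph V) (w : Sym2 V → ℝ)
    (hw : ∀ e, 0 ≤ w e) (lam : ℝ) (hlam : 0 < lam) (S : Finset V) (v : V) :
    ECdil G w lam S ≤ lam / 2 + ECdil G w lam (S.erase v) := by
  obtain ⟨F, hF, h⟩ := ECdil_attained G w lam (S.erase v)
  have h1 := ECdil_le G w hw lam hlam S F hF
  have h2 : (S.filter (fun s => ∀ e ∈ F, s ∉ e)).card ≤
      ((S.erase v).filter (fun s => ∀ e ∈ F, s ∉ e)).card + 1 := by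
    refine le_trans (Finset.card_le_card ?_) (Finset.card_insert_le v _)
    intro s hs
    simp only [Finset.mem_filter, Finset.mem_insert, Finset.mem_erase] at *
    tauto
  have h3 : ((S.filter (fun s => ∀ e ∈ F, s ∉ e)).card : ℝ) ≤
      (((S.erase v).filter (fun s => ∀ e ∈ F, s ∉ e)).card : ℝ) + 1 := by exact_mod_cast h2
  have h4 := mul_le_mul_of_nonneg_left h3 (by positivity : 0 ≤ lam / 2)
  linarith

theorem ECdil_le_edge {V : Type*} [Fintype V] (G : SimpleGraph V) (w : Sym2 V → ℝ)
    (hw : ∀ e, 0 ≤ w e) (lam : ℝ) (hlam : 0 < lam) (S : Finset V) (v u : V) (h : G.Adj v u) :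
    ECdil G w lam S ≤ w s(v, u) + ECdil G w lam ((S.erase v).erase u) := by
  obtain ⟨F, hF, h0⟩ := ECdil_attained G w lam ((S.erase v).erase u)
  have h1 := ECdil_le G w hw lam hlam S (insert s(v, u) F) (by
    intro e he
    rcases Finset.mem_insert.1 he with rfl | he
    · exact h
    · exact hF e he)
  have h2 : (S.filter (fun s => ∀ e ∈ insert s(v, u) F, s ∉ e)).card ≤
      (((S.erase v).erase u).filter (fun s => ∀ e ∈ F, s ∉ e)).card := by
    refine Finset.card_le_card ?_
    intro s hs
    simp only [Finset.mem_filter, Finset.mem_erase, Finset.forall_mem_insert,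
      Sym2.mem_iff] at *
    tauto
  have h3 : ((S.filter (fun s => ∀ e ∈ insert s(v, u) F, s ∉ e)).card : ℝ) ≤
      ((((S.erase v).erase u).filter (fun s => ∀ e ∈ F, s ∉ e)).card : ℝ) := by
    exact_mod_cast h2
  have h4 := mul_le_mul_of_nonneg_left h3 (by positivity : 0 ≤ lam / 2)
  have h5 : ∑ e ∈ insert s(v, u) F, w e ≤ w s(v, u) + ∑ e ∈ F, w e := by
    by_cases hm : s(v, u) ∈ F
    · rw [Finset.insert_eq_of_mem hm]
      linarith [hw s(v, u)]
    · rw [Finset.sum_insert hm]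
  linarith

theorem ECdil_cases {V : Type*} [Fintype V] (G : SimpleGraph V) (w : Sym2 V → ℝ)
    (hw : ∀ e, 0 ≤ w e) (lam : ℝ) (hlam : 0 < lam) (S : Finset V) (v : V) (hv : v ∈ S) :
    lam / 2 + ECdil G w lam (S.erase v) ≤ ECdil G w lam S ∨
    ∃ u, G.Adj v u ∧ w s(v, u) + ECdil G w lam ((S.erase v).erase u) ≤ ECdil G w lam S := by
  obtain ⟨F, hF, h0⟩ := ECdil_attained G w lam S
  by_cases hc : ∀ e ∈ F, v ∉ e
  · left
    have h1 := ECdil_le G w hw lam hlam (S.erase v) F hF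
    have h2 : ((S.erase v).filter (fun s => ∀ e ∈ F, s ∉ e)).card + 1 =
        (S.filter (fun s => ∀ e ∈ F, s ∉ e)).card := by
      rw [Finset.filter_erase]
      exact Finset.card_erase_add_one (Finset.mem_filter.2 ⟨hv, hc⟩)
    rw [h0, ← h2]
    push_cast
    linarith
  · right
    push Not at hc
    obtain ⟨e, he, hve⟩ := hc
    obtain ⟨u, rfl⟩ := hve
    refine ⟨u, hF _ he, ?_⟩
    have h1 := ECdil_le G w hw lam hlam ((S.erase v).erase u) (F.erase s(v, u))
      (fun e he => hF e (Finset.mem_of_mem_erase he))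
    have h2 : (((S.erase v).erase u).filter (fun s => ∀ e ∈ F.erase s(v, u), s ∉ e)).card ≤
        (S.filter (fun s => ∀ e ∈ F, s ∉ e)).card := by
      refine Finset.card_le_card ?_
      intro s hs
      simp only [Finset.mem_filter, Finset.mem_erase] at *
      refine ⟨hs.1.2.2, fun e he hse => ?_⟩
      by_cases hee : e = s(v, u)
      · subst hee
        rw [Sym2.mem_iff] at hse
        tauto
      · exact hs.2 e ⟨hee, he⟩ hse
    have h3 : ((((S.erase v).erase u).filter
        (fun s => ∀ e ∈ F.erase s(v, u), s ∉ e)).card : ℝ) ≤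
        ((S.filter (fun s => ∀ e ∈ F, s ∉ e)).card : ℝ) := by exact_mod_cast h2
    have h4 := mul_le_mul_of_nonneg_left h3 (by positivity : 0 ≤ lam / 2)
    have h5 := Finset.add_sum_erase F w he
    linarith

/-- **Recursion for the diluted edge cover increment.**
Let `G` be a finite graph with nonnegative edge weights `w`, `λ > 0`, `S` a subset of the
vertices, and `v ∈ S`.  If `v` has at least one neighbor in `G`, then
`h_λ(v, G, S) = min(λ/2, min over neighbors u of v of (w(v,u) - h_λ(u, G, S \ {v})))`;
if `v` has no neighbors, then `h_λ(v, G, S) = λ/2`. -/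
theorem hdil_recursion
    {V : Type*} [Fintype V] [DecidableEq V] (G : SimpleGraph V)
    (w : Sym2 V → ℝ) (hw : ∀ e, 0 ≤ w e)
    (lam : ℝ) (hlam : 0 < lam)
    (S : Finset V) (v : V) (hv : v ∈ S) :
    (∀ hne : (G.neighborFinset v).Nonempty,
      hdil G w lam v S =
        min (lam / 2)
          ((G.neighborFinset v).inf' hne
            (fun u => w s(v, u) - hdil G w lam u (S.erase v)))) ∧
    (G.neighborFinset v = ∅ → hdil G w lam v S = lam / 2) := by
  obtain rfl : ‹DecidableEq V› = fun a b => Classical.propDecidable (a = b) :=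
    Subsingleton.elim _ _
  have hA := ECdil_le_half G w hw lam hlam S v
  have hC := ECdil_cases G w hw lam hlam S v hv
  constructor
  · intro hne
    apply le_antisymm
    · refine le_min ?_ (Finset.le_inf' _ _ fun u hu => ?_)
      · unfold hdil
        linarith
      · have := ECdil_le_edge G w hw lam hlam S v u ((G.mem_neighborFinset v u).1 hu)
        unfold hdil
        linarith
    · rcases hC with h | ⟨u, hu, h⟩
      · refine (min_le_left _ _).trans ?_
        unfold hdil
        linarith
      · refine (min_le_right _ _).trans
          ((Finset.inf'_le _ ((G.mem_neighborFinset v u).2 hu)).trans ?_)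
        unfold hdil
        linarith
  · intro he
    rcases hC with h | ⟨u, hu, h⟩
    · unfold hdil
      linarith
    · have := (G.mem_neighborFinset v u).2 hu
      rw [he] at this
      simp at this
end

section
/- Fixed point of the edge cover recursion operator (Lemma 4.11): For every λ > 0 there is a unique A_λ ≥ 0 satisfying A_λ = e^{−A_λ} (1 − e^{−λ/2}), and the function F_λ : [0, λ/2] → [0,1] defined by F_λ(x) := e^{−A_λ} e^{−x} is a fixed point of V_λ, i.e., (V_λ F_λ)(x) = F_λ(x) for all x ∈ [0, λ/2]. -/
open MeasureTheory intervalIntegral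

/-- The edge cover recursion operator: `(V_λ F)(x) = exp(-∫₀^{λ/2} F(ℓ) dℓ) · e^{-x}`. -/
noncomputable def Vop (lam : ℝ) (F : ℝ → ℝ) : ℝ → ℝ :=
  fun x => Real.exp (-(∫ ℓ in (0 : ℝ)..(lam / 2), F ℓ)) * Real.exp (-x)

/-- **Fixed point of the edge cover recursion operator.**
For every `λ > 0` there is a unique `A_λ ≥ 0` with `A_λ = e^{-A_λ}(1 - e^{-λ/2})`, and for
this `A_λ` the function `F_λ(x) = e^{-A_λ} e^{-x}` (which maps `[0, λ/2]` into `[0,1]`) is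
a fixed point of `V_λ` on `[0, λ/2]`. -/
theorem Vop_fixed_point (lam : ℝ) (hlam : 0 < lam) :
    (∃! A : ℝ, 0 ≤ A ∧ A = Real.exp (-A) * (1 - Real.exp (-(lam / 2)))) ∧
    ∀ A : ℝ, 0 ≤ A → A = Real.exp (-A) * (1 - Real.exp (-(lam / 2))) →
      ∀ x ∈ Set.Icc (0 : ℝ) (lam / 2),
        Vop lam (fun y => Real.exp (-A) * Real.exp (-y)) x
          = Real.exp (-A) * Real.exp (-x) := by

  have hc : 0 < 1 - Real.exp (-(lam / 2)) := by
    have : Real.exp (-(lam / 2)) < 1 := Real.exp_lt_one_iff.2 (by linarith)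
    linarith
  have hc1 : 1 - Real.exp (-(lam / 2)) ≤ 1 := by
    have := Real.exp_pos (-(lam / 2))
    linarith
  refine ⟨?_, ?_⟩
  · generalize 1 - Real.exp (-(lam / 2)) = c at hc hc1
    have hcont : ContinuousOn (fun A : ℝ => A - Real.exp (-A) * c) (Set.Icc 0 1) := by
      fun_prop
    have hmem : (0 : ℝ) ∈ Set.Icc ((fun A : ℝ => A - Real.exp (-A) * c) 0)
        ((fun A : ℝ => A - Real.exp (-A) * c) 1) := by
      have h1 : Real.exp (-1) < 1 := Real.exp_lt_one_iff.2 (by norm_num)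
      have h0 := Real.exp_pos (-1)
      refine ⟨by simpa using hc.le, ?_⟩
      simp only
      nlinarith
    obtain ⟨A, hA, hAe⟩ := intermediate_value_Icc (zero_le_one) hcont hmem
    refine ⟨A, ⟨hA.1, by simp only at hAe; linarith⟩, ?_⟩
    rintro B ⟨_, hB⟩
    have hA' : A = Real.exp (-A) * c := by simp only at hAe; linarith
    rcases lt_trichotomy B A with h | h | h
    · have : Real.exp (-A) < Real.exp (-B) := Real.exp_lt_exp.2 (by linarith)
      nlinarith
    · exact h
    · have : Real.exp (-B) < Real.exp (-A) := Real.exp_lt_exp.2 (by linarith)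
      nlinarith
  · intro A _ hA x _
    have hi : ∫ y in (0 : ℝ)..(lam / 2), Real.exp (-A) * Real.exp (-y) = A := by
      rw [intervalIntegral.integral_const_mul,
        intervalIntegral.integral_comp_neg (fun y => Real.exp y), integral_exp]
      simpa using hA.symm
    simp only [Vop, hi]
end

section
/- Antitonicity and sandwiching for the edge cover recursion operator (Lemma 4.12): Let λ > 0. (i) For measurable F, G : [0, λ/2] → [0,1] with F ≤ G pointwise, one has V_λ F ≥ V_λ G pointwise. (ii) Define F₀ ≡ 0 and G₀ ≡ 1 on [0, λ/2], and recursively F_{k+1} := V_λ G_k and G_{k+1} := V_λ F_k. Then for every k ≥ 0, pointwise on [0, λ/2]: F_k ≤ F_λ ≤ G_k, F_k ≤ F_{k+1}, and G_{k+1} ≤ G_k, where F_λ(x) := e^{−A_λ} e^{−x} and A_λ ≥ 0 is the unique solution of A_λ = e^{−A_λ}(1 − e^{−λ/2}). -/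
open MeasureTheory intervalIntegral

/-- The pair `(F_k, G_k)` of iterates of the edge cover recursion operator, started from
`F₀ ≡ 0`, `G₀ ≡ 1`, with `F_{k+1} = V_λ G_k` and `G_{k+1} = V_λ F_k`. -/
noncomputable def FGseq (lam : ℝ) : ℕ → (ℝ → ℝ) × (ℝ → ℝ)
  | 0 => (fun _ => 0, fun _ => 1)
  | k + 1 => (Vop lam (FGseq lam k).2, Vop lam (FGseq lam k).1)

theorem Vop_anti_aux (lam : ℝ) (hlam : 0 < lam) (F G : ℝ → ℝ)
    (hF : IntervalIntegrable F volume 0 (lam / 2)) (hG : IntervalIntegrable G volume 0 (lam / 2))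
    (h : ∀ x ∈ Set.Icc (0 : ℝ) (lam / 2), F x ≤ G x) (x : ℝ) : Vop lam G x ≤ Vop lam F x := by
  have := intervalIntegral.integral_mono_on (by positivity) hF hG h
  unfold Vop
  gcongr

theorem Vop_cont_aux (lam : ℝ) (F : ℝ → ℝ) : Continuous (Vop lam F) := by
  unfold Vop
  fun_prop

theorem FGseq_cont_aux (lam : ℝ) (k : ℕ) :
    Continuous (FGseq lam k).1 ∧ Continuous (FGseq lam k).2 := by
  cases k with
  | zero => exact ⟨continuous_const, continuous_const⟩
  | succ k => exact ⟨Vop_cont_aux _ _, Vop_cont_aux _ _⟩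

theorem Vop_fixed_aux (lam A : ℝ) (hA : A = Real.exp (-A) * (1 - Real.exp (-(lam / 2)))) :
    Vop lam (fun x => Real.exp (-A) * Real.exp (-x)) = fun x => Real.exp (-A) * Real.exp (-x) := by
  have h : (∫ l in (0 : ℝ)..(lam / 2), Real.exp (-A) * Real.exp (-l)) = A := by
    rw [intervalIntegral.integral_const_mul,
      intervalIntegral.integral_comp_neg (fun x => Real.exp x), integral_exp]
    simpa using hA.symm
  funext x
  simp only [Vop, h]

theorem integrable_aux (lam : ℝ) (hlam : 0 < lam) (F : ℝ → ℝ) (hm : Measurable F)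
    (h : ∀ x ∈ Set.Icc (0 : ℝ) (lam / 2), F x ∈ Set.Icc (0 : ℝ) 1) :
    IntervalIntegrable F volume 0 (lam / 2) := by
  rw [intervalIntegrable_iff_integrableOn_Icc_of_le (by positivity)]
  refine Measure.integrableOn_of_bounded (M := 1) (by simp) hm.aestronglyMeasurable ?_
  refine (ae_restrict_iff' measurableSet_Icc).2 (Filter.Eventually.of_forall fun x hx => ?_)
  rw [Real.norm_eq_abs, abs_of_nonneg (h x hx).1]
  exact (h x hx).2

/-- **Antitonicity and sandwiching for the edge cover recursion operator.**
Let `λ > 0` and let `A_λ ≥ 0` satisfy `A_λ = e^{-A_λ}(1 - e^{-λ/2})`, with fixed point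
`F_λ(x) = e^{-A_λ} e^{-x}`.  (i) The operator `V_λ` is antitone: for measurable
`F, G : [0,λ/2] → [0,1]` with `F ≤ G` pointwise on `[0,λ/2]`, one has `V_λ F ≥ V_λ G` on
`[0,λ/2]`.  (ii) For the iterates `F₀ ≡ 0`, `G₀ ≡ 1`, `F_{k+1} = V_λ G_k`,
`G_{k+1} = V_λ F_k`, one has, pointwise on `[0,λ/2]` and for every `k`:
`F_k ≤ F_λ ≤ G_k`, `F_k ≤ F_{k+1}`, and `G_{k+1} ≤ G_k`. -/
theorem Vop_antitone_and_sandwich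
    (lam : ℝ) (hlam : 0 < lam)
    (A : ℝ) (hA0 : 0 ≤ A) (hA : A = Real.exp (-A) * (1 - Real.exp (-(lam / 2)))) :
    (∀ F G : ℝ → ℝ, Measurable F → Measurable G →
      (∀ x ∈ Set.Icc (0 : ℝ) (lam / 2), F x ∈ Set.Icc (0 : ℝ) 1) →
      (∀ x ∈ Set.Icc (0 : ℝ) (lam / 2), G x ∈ Set.Icc (0 : ℝ) 1) →
      (∀ x ∈ Set.Icc (0 : ℝ) (lam / 2), F x ≤ G x) →
      ∀ x ∈ Set.Icc (0 : ℝ) (lam / 2), Vop lam G x ≤ Vop lam F x) ∧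
    (∀ k : ℕ, ∀ x ∈ Set.Icc (0 : ℝ) (lam / 2),
      (FGseq lam k).1 x ≤ Real.exp (-A) * Real.exp (-x) ∧
      Real.exp (-A) * Real.exp (-x) ≤ (FGseq lam k).2 x ∧
      (FGseq lam k).1 x ≤ (FGseq lam (k + 1)).1 x ∧
      (FGseq lam (k + 1)).2 x ≤ (FGseq lam k).2 x) := by
  refine ⟨fun F G hFm hGm hF hG hle x _ => Vop_anti_aux lam hlam F G
    (integrable_aux lam hlam F hFm hF) (integrable_aux lam hlam G hGm hG) hle x, ?_⟩
  have anti : ∀ F G : ℝ → ℝ, Continuous F → Continuous G →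
      (∀ x ∈ Set.Icc (0 : ℝ) (lam / 2), F x ≤ G x) → ∀ x, Vop lam G x ≤ Vop lam F x :=
    fun F G hF hG h x => Vop_anti_aux lam hlam F G (hF.intervalIntegrable _ _)
      (hG.intervalIntegrable _ _) h x
  have hfix := Vop_fixed_aux lam A hA
  have hc : Continuous (fun x : ℝ => Real.exp (-A) * Real.exp (-x)) := by fun_prop
  intro k
  induction k with
  | zero =>
    intro x hx
    refine ⟨?_, ?_, ?_, ?_⟩
    · simp only [FGseq]; positivity
    · simp only [FGseq]
      rw [← Real.exp_add, Real.exp_le_one_iff]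
      linarith [hx.1]
    · simp only [FGseq, Vop]; positivity
    · simp only [FGseq, Vop]
      simpa using hx.1
  | succ k ih =>
    intro x hx
    have c := FGseq_cont_aux lam k
    have c' := FGseq_cont_aux lam (k + 1)
    refine ⟨?_, ?_, ?_, ?_⟩
    · have := anti _ _ hc c.2 (fun y hy => (ih y hy).2.1) x
      rwa [hfix] at this
    · have := anti _ _ c.1 hc (fun y hy => (ih y hy).1) x
      rwa [hfix] at this
    · exact anti _ _ c'.2 c.2 (fun y hy => (ih y hy).2.2.2) x
    · exact anti _ _ c.1 c'.1 (fun y hy => (ih y hy).2.2.1) x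
end

section
/- Exponential convergence to the fixed point of the edge cover recursion (Proposition 4.13): Let λ > 0, define F₀ ≡ 0 and G₀ ≡ 1 on [0, λ/2], and recursively F_{k+1} := V_λ G_k, G_{k+1} := V_λ F_k. Then for every k ≥ 0 and every x ∈ [0, λ/2]: 0 ≤ G_{k+1}(x) − F_λ(x) ≤ A_λ e^{−⌊k/2⌋ A_λ} e^{−x} and 0 ≤ F_λ(x) − F_{k+1}(x) ≤ λ A_λ e^{−⌊k/2⌋ A_λ} e^{−x}, where F_λ(x) := e^{−A_λ} e^{−x} and A_λ ≥ 0 is the unique solution of A_λ = e^{−A_λ}(1 − e^{−λ/2}). -/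
open MeasureTheory intervalIntegral

lemma Vop_aux (lam c : ℝ) (F : ℝ → ℝ) (hF : F = fun x => c * Real.exp (-x)) :
    Vop lam F = fun x => Real.exp (-((1 - Real.exp (-(lam / 2))) * c)) * Real.exp (-x) := by
  subst hF
  funext x
  have h : (∫ ℓ in (0 : ℝ)..(lam / 2), Real.exp (-ℓ)) = 1 - Real.exp (-(lam / 2)) := by
    rw [intervalIntegral.integral_comp_neg (fun x => Real.exp x)]
    simp
  simp only [Vop]
  rw [intervalIntegral.integral_const_mul, h, mul_comm c]

lemma exp_diff_aux (p q : ℝ) : Real.exp p - Real.exp q ≤ Real.exp p * (p - q) := by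
  have h := Real.add_one_le_exp (q - p)
  have h2 : Real.exp q = Real.exp p * Real.exp (q - p) := by
    rw [← Real.exp_add]; congr 1; ring
  rw [h2]
  nlinarith [Real.exp_pos p]

lemma up_aux (s E A P Q b : ℝ) (hs0 : 0 ≤ s) (hs1 : s ≤ 1) (hE : E = Real.exp (-A))
    (hA : A = s * E) (hQ0 : 0 ≤ Q) (hQ : Q ≤ E) (hb : E - Q ≤ b)
    (hP : P = Real.exp (-(s * Q))) : E ≤ P ∧ P - E ≤ b := by
  have h1 : 0 ≤ s * (E - Q) := mul_nonneg hs0 (by linarith)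
  have h2 : s * (E - Q) ≤ E - Q := by nlinarith
  have hle : P ≤ 1 := by
    rw [hP]; exact Real.exp_le_one_iff.mpr (by nlinarith)
  constructor
  · rw [hP, hE]; apply Real.exp_le_exp.mpr; nlinarith
  · have h := exp_diff_aux (-(s * Q)) (-A)
    rw [← hE, ← hP] at h
    have h3 : -(s * Q) - -A = s * (E - Q) := by rw [hA]; ring
    rw [h3] at h
    nlinarith

lemma down_aux (s E A P Q a : ℝ) (hs0 : 0 ≤ s) (hs1 : s ≤ 1) (hE : E = Real.exp (-A))
    (hA : A = s * E) (hP : E ≤ P) (ha : P - E ≤ a)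
    (hQ : Q = Real.exp (-(s * P))) : 0 ≤ Q ∧ Q ≤ E ∧ E - Q ≤ E * a := by
  have h1 : 0 ≤ s * (P - E) := mul_nonneg hs0 (by linarith)
  have h2 : s * (P - E) ≤ P - E := by nlinarith
  have hEp : 0 < E := hE ▸ Real.exp_pos _
  refine ⟨hQ ▸ (Real.exp_pos _).le, ?_, ?_⟩
  · rw [hQ, hE]; apply Real.exp_le_exp.mpr; nlinarith
  · have h := exp_diff_aux (-A) (-(s * P))
    rw [← hE, ← hQ] at h
    have h3 : -A - -(s * P) = s * (P - E) := by rw [hA]; ring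
    rw [h3] at h
    exact h.trans (mul_le_mul_of_nonneg_left (h2.trans ha) hEp.le)

lemma main_aux (lam : ℝ) (hlam : 0 < lam) (s E A : ℝ) (hs : s = 1 - Real.exp (-(lam / 2)))
    (hE : E = Real.exp (-A)) (hA0 : 0 ≤ A) (hA : A = s * E) : ∀ k : ℕ, ∃ P Q : ℝ,
      (FGseq lam (k + 1)).2 = (fun x => P * Real.exp (-x)) ∧
      (FGseq lam (k + 1)).1 = (fun x => Q * Real.exp (-x)) ∧
      E ≤ P ∧ P - E ≤ A * Real.exp (-((k / 2 : ℕ) : ℝ) * A) ∧ 0 ≤ Q ∧ Q ≤ E ∧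
      E - Q ≤ lam * A * Real.exp (-((k / 2 : ℕ) : ℝ) * A) := by
  have hs0 : 0 ≤ s := by
    have : Real.exp (-(lam / 2)) ≤ 1 := Real.exp_le_one_iff.mpr (by linarith)
    linarith
  have hs1 : s ≤ 1 := by have := Real.exp_pos (-(lam / 2)); linarith
  have hst : s ≤ lam / 2 := by have := Real.add_one_le_exp (-(lam / 2)); linarith
  have hE1 : E ≤ 1 := by rw [hE]; exact Real.exp_le_one_iff.mpr (by linarith)
  have hEp : 0 < E := hE ▸ Real.exp_pos _
  have hAs : A ≤ s := by nlinarith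
  have hEA : 1 - E ≤ A := by have := Real.add_one_le_exp (-A); linarith
  have hG1 : (FGseq lam 1).2 = (fun x => 1 * Real.exp (-x)) := by
    funext x; simp [FGseq, Vop]
  have hF1 : (FGseq lam 1).1 = (fun x => Real.exp (-(lam / 2)) * Real.exp (-x)) := by
    funext x; simp [FGseq, Vop]
  have hq0 : Real.exp (-(lam / 2)) ≤ E := by
    rw [hE]; apply Real.exp_le_exp.mpr; linarith
  have hb0 : E - Real.exp (-(lam / 2)) ≤ lam * A := by
    have h1 := exp_diff_aux (-A) 0
    have h2 := Real.add_one_le_exp (-(lam / 2))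
    rw [← hE, Real.exp_zero] at h1
    have ht : Real.exp (-(lam / 2)) = 1 - s := by linarith
    rw [ht] at h2 ⊢
    have h3 : E - (1 - s) = A - (1 - s) * (1 - E) := by rw [hA]; ring
    have h4 : (1 - s) * (A * E) ≤ (1 - s) * (1 - E) :=
      mul_le_mul_of_nonneg_left (by linarith) (by linarith)
    have h5 : 1 - (1 - s) * E ≤ lam := by nlinarith
    have h6 := mul_le_mul_of_nonneg_left h5 hA0
    nlinarith
  have step : ∀ k P Q, (FGseq lam k).2 = (fun x => P * Real.exp (-x)) →
      (FGseq lam k).1 = (fun x => Q * Real.exp (-x)) →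
      (FGseq lam (k + 1)).2 = (fun x => Real.exp (-(s * Q)) * Real.exp (-x)) ∧
      (FGseq lam (k + 1)).1 = (fun x => Real.exp (-(s * P)) * Real.exp (-x)) := by
    intro k P Q h1 h2
    rw [hs]
    exact ⟨Vop_aux lam Q _ h2, Vop_aux lam P _ h1⟩
  intro k
  induction k using Nat.twoStepInduction with
  | zero =>
    refine ⟨1, _, hG1, hF1, hE1, ?_, (Real.exp_pos _).le, hq0, ?_⟩ <;> simp <;> linarith
  | one =>
    obtain ⟨h1, h2⟩ := step 1 _ _ hG1 hF1
    have u := up_aux s E A _ _ _ hs0 hs1 hE hA (Real.exp_pos _).le hq0 le_rfl rfl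
    have d := down_aux s E A _ _ _ hs0 hs1 hE hA hE1 le_rfl rfl
    refine ⟨_, _, h1, h2, u.1, ?_, d.1, d.2.1, ?_⟩
    · have : Real.exp (-(s * Real.exp (-(lam / 2)))) ≤ 1 :=
        Real.exp_le_one_iff.mpr (by nlinarith [Real.exp_pos (-(lam / 2))])
      norm_num
      linarith
    · have : Real.exp (-(lam / 2)) ≤ Real.exp (-(s * 1)) :=
        Real.exp_le_exp.mpr (by linarith)
      rw [mul_one] at this
      norm_num
      linarith
  | more k ih _ =>
    obtain ⟨P, Q, h1, h2, hP, ha, hQ0, hQ, hb⟩ := ih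
    obtain ⟨h3, h4⟩ := step _ _ _ h1 h2
    obtain ⟨h5, h6⟩ := step _ _ _ h3 h4
    have u := up_aux s E A _ _ _ hs0 hs1 hE hA hQ0 hQ hb rfl
    have d := down_aux s E A _ _ _ hs0 hs1 hE hA hP ha rfl
    have u2 := up_aux s E A _ _ _ hs0 hs1 hE hA d.1 d.2.1 d.2.2 rfl
    have d2 := down_aux s E A _ _ _ hs0 hs1 hE hA u.1 u.2 rfl
    have hr : Real.exp (-(((k + 2) / 2 : ℕ) : ℝ) * A)
        = E * Real.exp (-((k / 2 : ℕ) : ℝ) * A) := by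
      have : (k + 2) / 2 = k / 2 + 1 := by omega
      rw [this, hE, ← Real.exp_add]
      push_cast
      congr 1
      ring
    refine ⟨_, _, h5, h6, u2.1, ?_, d2.1, d2.2.1, ?_⟩
    · rw [hr]; linarith [u2.2]
    · rw [hr]; linarith [d2.2.2]

/-- **Exponential convergence to the fixed point of the edge cover recursion.**
Let `λ > 0` and let `A_λ ≥ 0` be the unique solution of `A_λ = e^{-A_λ}(1 - e^{-λ/2})`,
with fixed point `F_λ(x) = e^{-A_λ} e^{-x}`.  For the iterates `F₀ ≡ 0`, `G₀ ≡ 1`,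
`F_{k+1} = V_λ G_k`, `G_{k+1} = V_λ F_k`, one has for every `k ≥ 0` and every
`x ∈ [0, λ/2]`:
`0 ≤ G_{k+1}(x) - F_λ(x) ≤ A_λ e^{-⌊k/2⌋ A_λ} e^{-x}` and
`0 ≤ F_λ(x) - F_{k+1}(x) ≤ λ A_λ e^{-⌊k/2⌋ A_λ} e^{-x}`. -/
theorem Vop_exponential_convergence
    (lam : ℝ) (hlam : 0 < lam)
    (A : ℝ) (hA0 : 0 ≤ A) (hA : A = Real.exp (-A) * (1 - Real.exp (-(lam / 2)))) :
    ∀ k : ℕ, ∀ x ∈ Set.Icc (0 : ℝ) (lam / 2),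
      (0 ≤ (FGseq lam (k + 1)).2 x - Real.exp (-A) * Real.exp (-x) ∧
        (FGseq lam (k + 1)).2 x - Real.exp (-A) * Real.exp (-x)
          ≤ A * Real.exp (-((k / 2 : ℕ) : ℝ) * A) * Real.exp (-x)) ∧
      (0 ≤ Real.exp (-A) * Real.exp (-x) - (FGseq lam (k + 1)).1 x ∧
        Real.exp (-A) * Real.exp (-x) - (FGseq lam (k + 1)).1 x
          ≤ lam * A * Real.exp (-((k / 2 : ℕ) : ℝ) * A) * Real.exp (-x)) := by
  intro k x _
  obtain ⟨P, Q, h1, h2, hP, ha, _, hQ, hb⟩ :=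
    main_aux lam hlam _ _ A rfl rfl hA0 (by rw [mul_comm]; exact hA) k
  rw [h1, h2]
  have hx := (Real.exp_pos (-x)).le
  refine ⟨⟨?_, ?_⟩, ?_, ?_⟩
  · rw [← sub_mul]; exact mul_nonneg (by linarith) hx
  · rw [← sub_mul]; exact mul_le_mul_of_nonneg_right ha hx
  · rw [← sub_mul]; exact mul_nonneg (by linarith) hx
  · rw [← sub_mul]; exact mul_le_mul_of_nonneg_right hb hx
end
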